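/- The integral over ℝ of z·Φ(z)·φ(z) dz equals 1/(2√π), where φ is the standard normal density and Φ the standard normal cumulative distribution function. -/

import Mathlib

open MeasureTheory

/-- The standard normal density φ(z) = (1/√(2π))·e^{−z²/2}. -/
noncomputable def stdNormalPDF (z : ℝ) : ℝ :=
  (Real.sqrt (2 * Real.pi))⁻¹ * Real.exp (-(z ^ 2) / 2)

/-- The standard normal cumulative distribution function Φ. -/
noncomputable def stdNormalCDF (x : ℝ) : ℝ :=
  ∫ z in Set.Iic x, stdNormalPDF z

lemma stdNormalPDF_nonneg (z : ℝ) : 0 ≤ stdNormalPDF z := by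
  unfold stdNormalPDF
  positivity

lemma continuous_stdNormalPDF : Continuous stdNormalPDF := by
  unfold stdNormalPDF
  fun_prop

lemma integrable_stdNormalPDF : Integrable stdNormalPDF := by
  refine ((integrable_exp_neg_mul_sq (b := 1 / 2) (by norm_num)).const_mul
    (Real.sqrt (2 * Real.pi))⁻¹).congr (.of_forall fun z => ?_)
  simp only [stdNormalPDF]
  ring_nf

lemma integrable_mul_stdNormalPDF : Integrable fun z : ℝ => z * stdNormalPDF z := by
  refine ((integrable_mul_exp_neg_mul_sq (b := 1 / 2) (by norm_num)).const_mul
    (Real.sqrt (2 * Real.pi))⁻¹).congr (.of_forall fun z => ?_)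
  simp only [stdNormalPDF]
  ring_nf

lemma hasDerivAt_stdNormalPDF (z : ℝ) :
    HasDerivAt stdNormalPDF (-(z * stdNormalPDF z)) z := by
  have h := ((((hasDerivAt_id z).pow 2).neg.div_const 2).exp).const_mul
    (Real.sqrt (2 * Real.pi))⁻¹
  refine h.congr_deriv ?_
  simp only [stdNormalPDF, id, Pi.neg_apply, Pi.pow_apply]
  ring

lemma hasDerivAt_stdNormalCDF (x : ℝ) : HasDerivAt stdNormalCDF (stdNormalPDF x) x := by
  have h := (intervalIntegral.integral_hasDerivAt_right
    (continuous_stdNormalPDF.intervalIntegrable 0 x)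
    continuous_stdNormalPDF.stronglyMeasurable.stronglyMeasurableAtFilter
    continuous_stdNormalPDF.continuousAt).const_add (stdNormalCDF 0)
  refine h.congr_of_eventuallyEq (.of_forall fun y => ?_)
  have hy := intervalIntegral.integral_Iic_sub_Iic (a := 0) (b := y)
    integrable_stdNormalPDF.integrableOn integrable_stdNormalPDF.integrableOn
  simp only [stdNormalCDF]
  linarith

lemma norm_stdNormalCDF_le (x : ℝ) : ‖stdNormalCDF x‖ ≤ ∫ z, stdNormalPDF z := by
  rw [stdNormalCDF, Real.norm_of_nonneg (integral_nonneg stdNormalPDF_nonneg)]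
  exact setIntegral_le_integral integrable_stdNormalPDF (.of_forall stdNormalPDF_nonneg)

lemma MeasureTheory.Integrable.stdNormalCDF_mul {f : ℝ → ℝ} (hf : Integrable f) :
    Integrable fun z => stdNormalCDF z * f z :=
  hf.bdd_mul
    (continuous_iff_continuousAt.2
      fun x => (hasDerivAt_stdNormalCDF x).continuousAt).aestronglyMeasurable
    (.of_forall norm_stdNormalCDF_le)

lemma stdNormalPDF_mul_self (z : ℝ) :
    stdNormalPDF z * stdNormalPDF z = (2 * Real.pi)⁻¹ * Real.exp (-1 * z ^ 2) := by
  have h : Real.exp (-1 * z ^ 2) = Real.exp (-(z ^ 2) / 2) * Real.exp (-(z ^ 2) / 2) := by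
    rw [← Real.exp_add]
    ring_nf
  rw [h, stdNormalPDF, mul_mul_mul_comm, ← mul_inv, Real.mul_self_sqrt (by positivity)]

lemma integrable_stdNormalPDF_mul_self :
    Integrable fun z => stdNormalPDF z * stdNormalPDF z := by
  simp only [stdNormalPDF_mul_self]
  exact (integrable_exp_neg_mul_sq one_pos).const_mul _

lemma integral_stdNormalPDF_mul_self :
    ∫ z, stdNormalPDF z * stdNormalPDF z = 1 / (2 * Real.sqrt Real.pi) := by
  simp only [stdNormalPDF_mul_self]
  rw [integral_const_mul, integral_gaussian, div_one]
  have hpi : Real.sqrt Real.pi ≠ 0 := (Real.sqrt_pos.2 Real.pi_pos).ne'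
  have hsq := Real.sq_sqrt Real.pi_pos.le
  field_simp
  exact hsq

theorem stmt_2 :
    ∫ z : ℝ, z * stdNormalCDF z * stdNormalPDF z = 1 / (2 * Real.sqrt Real.pi) := by
  have h := integral_mul_deriv_eq_deriv_mul_of_integrable
    (fun x _ => hasDerivAt_stdNormalCDF x) (fun x _ => hasDerivAt_stdNormalPDF x)
    integrable_mul_stdNormalPDF.neg.stdNormalCDF_mul
    integrable_stdNormalPDF_mul_self
    integrable_stdNormalPDF.stdNormalCDF_mul
  rw [integral_stdNormalPDF_mul_self] at h
  rw [← neg_inj, ← h, ← integral_neg]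
  congr with z
  ring
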